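/- Let Ω ⊂ ℝ² be an open set and let φ : Ω → ℝ be a smooth function satisfying −(∂ₓ² + ∂_y²)φ = λ·φ on Ω for some real λ, with φ not identically zero on any connected component of Ω. Then the set of nodal critical points {z ∈ Ω : φ(z) = 0 and ∇φ(z) = 0} is discrete in Ω, and the nodal set φ⁻¹(0) has no isolated points: every point of φ⁻¹(0) is an accumulation point of φ⁻¹(0). -/

import Mathlib

open Set

noncomputable section

abbrev E2 : Type := EuclideanSpace ℝ (Fin 2)

/-- Second (mixed) directional derivative of `u` at `p`: first in direction `v`, then `w`. -/
def mixedDeriv (u : E2 → ℝ) (p v w : E2) : ℝ :=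
  fderiv ℝ (fun y => fderiv ℝ u y v) p w

/-- The (geometers') Laplacian `−(∂ₓ² + ∂_y²) u` at `p`. -/
def negLap (u : E2 → ℝ) (p : E2) : ℝ :=
  -(mixedDeriv u p (EuclideanSpace.single 0 1) (EuclideanSpace.single 0 1)
    + mixedDeriv u p (EuclideanSpace.single 1 1) (EuclideanSpace.single 1 1))


/-- One-dimensional mean value bound. -/
lemma aux_mvt (g g' : ℝ → ℝ) (B r : ℝ) (hr : 0 ≤ r) (hg : ∀ s, HasDerivAt g (g' s) s)
    (h0 : g 0 = 0) (hB : ∀ s ∈ Icc 0 r, |g' s| ≤ B) : |g r| ≤ B * r := by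
  have := (convex_Icc (0:ℝ) r).norm_image_sub_le_of_norm_hasDerivWithin_le
    (f := g) (f' := g') (C := B) (x := 0) (y := r)
    (fun x _ => (hg x).hasDerivWithinAt) (fun x hx => hB x hx) ⟨le_rfl, hr⟩ ⟨hr, le_rfl⟩
  simpa [h0, abs_of_nonneg hr] using this

/-- Taylor bound. -/
lemma aux_taylor (N : ℕ) : ∀ (a : ℕ → ℝ → ℝ) (C ρ : ℝ),
    (∀ k r, HasDerivAt (a k) (a (k+1) r) r) → (∀ j < N, a j 0 = 0) →
    (∀ r ∈ Icc 0 ρ, |a (N+1) r| ≤ C) → ∀ r ∈ Icc 0 ρ,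
    |a 0 r - a N 0 * r ^ N / (N.factorial : ℝ)| ≤ C * r ^ (N+1) := by
  induction N with
  | zero =>
    intro a C ρ ha _ hC r hr
    have := aux_mvt (fun s => a 0 s - a 0 0) (a 1) C r hr.1
      (fun s => (ha 0 s).sub_const _) (by simp)
      (fun s hs => hC s ⟨hs.1, hs.2.trans hr.2⟩)
    simpa using this
  | succ N ih =>
    intro a C ρ ha hz hC r hr
    have h1 := ih (fun k => a (k+1)) C ρ (fun k r => ha (k+1) r)
      (fun j hj => hz (j+1) (by omega)) hC
    have hC0 : 0 ≤ C := (abs_nonneg _).trans (hC r hr)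
    have := aux_mvt (fun s => a 0 s - a (N+1) 0 * s ^ (N+1) / ((N+1).factorial : ℝ))
      (fun s => a 1 s - a (N+1) 0 * s ^ N / (N.factorial : ℝ)) (C * r ^ (N+1)) r hr.1
      (fun s => by
        have h2 := (((hasDerivAt_pow (N+1) s).const_mul (a (N+1) 0)).div_const
          ((N+1).factorial : ℝ))
        refine ((ha 0 s).sub h2).congr_deriv ?_
        rw [Nat.factorial_succ]; push_cast
        have : (N.factorial : ℝ) ≠ 0 := by positivity
        have h3 : (N:ℝ) + 1 ≠ 0 := by positivity
        field_simp)
      (by simp [hz 0 (by omega)])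
      (fun s hs => (h1 s ⟨hs.1, hs.2.trans hr.2⟩).trans
        (mul_le_mul_of_nonneg_left (pow_le_pow_left₀ hs.1 hs.2 _) hC0))
    calc _ ≤ _ := this
      _ = _ := by ring

/-- If all derivatives at `0` vanish, the function vanishes to infinite order. -/
lemma aux_flat (a : ℕ → ℝ → ℝ) (ha : ∀ k r, HasDerivAt (a k) (a (k+1) r) r)
    (hz : ∀ j, a j 0 = 0) (N : ℕ) (ρ : ℝ) :
    ∃ C, 0 ≤ C ∧ ∀ r ∈ Icc 0 ρ, |a 0 r| ≤ C * r ^ (N+1) := by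
  have hc : Continuous (a (N+1)) :=
    continuous_iff_continuousAt.2 fun r => (ha (N+1) r).continuousAt
  obtain ⟨C, hC⟩ := (isCompact_Icc (a := (0:ℝ)) (b := ρ)).exists_bound_of_continuousOn
    hc.continuousOn
  refine ⟨max C 0, le_max_right _ _, fun r hr => ?_⟩
  have := aux_taylor N a (max C 0) ρ ha (fun j _ => hz j)
    (fun r hr => (hC r hr).trans (le_max_left _ _)) r hr
  simpa [hz N] using this

/-- The differentiated Euler-type equation at `0`. -/
lemma aux_seq (a b : ℕ → ℝ → ℝ) (R lam : ℝ) (hR : 0 < R)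
    (ha : ∀ k r, HasDerivAt (a k) (a (k+1) r) r) (hb : ∀ k r, HasDerivAt (b k) (b (k+1) r) r)
    (h : ∀ r, |r| < R → r^2 * a 2 r + r * a 1 r + b 0 r + lam * (r^2 * a 0 r) = 0) :
    b 0 0 = 0 ∧ a 1 0 + b 1 0 = 0 ∧
    ∀ k : ℕ, ((k:ℝ)+2)^2 * a (k+2) 0 + b (k+2) 0 + lam * (((k:ℝ)+2)*(k+1) * a k 0) = 0 := by
  have key : ∀ (f : ℝ → ℝ) (f' : ℝ → ℝ), (∀ r, HasDerivAt f (f' r) r) →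
      (∀ r, |r| < R → f r = 0) → ∀ r, |r| < R → f' r = 0 := by
    intro f f' hf h0 r hr
    have : f =ᶠ[nhds r] fun _ => 0 := by
      have : {s : ℝ | |s| < R} ∈ nhds r :=
        (isOpen_lt continuous_abs continuous_const).mem_nhds hr
      filter_upwards [this] with s hs using h0 s hs
    exact (hf r).unique ((hasDerivAt_const r (0:ℝ)).congr_of_eventuallyEq this)
  have hid : ∀ r : ℝ, HasDerivAt (fun r : ℝ => r) 1 r := hasDerivAt_id
  have hsq : ∀ r : ℝ, HasDerivAt (fun r : ℝ => r^2) (2*r) r := fun r => by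
    simpa using hasDerivAt_pow 2 r
  have h1 : ∀ r, |r| < R → r^2 * a 3 r + 3 * (r * a 2 r) + a 1 r + b 1 r +
      lam * (r^2 * a 1 r + 2 * (r * a 0 r)) = 0 := by
    refine key _ _ (fun r => ?_) h
    refine HasDerivAt.congr_deriv (((((hsq r).mul (ha 2 r)).add ((hid r).mul (ha 1 r))).add
      (hb 0 r)).add (((hsq r).mul (ha 0 r)).const_mul lam)) ?_
    simp only [Nat.reduceAdd, zero_add]; ring
  have h2 : ∀ k : ℕ, ∀ r, |r| < R → r^2 * a (k+4) r + (2*k+5) * (r * a (k+3) r) +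
      ((k:ℝ)+2)^2 * a (k+2) r + b (k+2) r +
      lam * (r^2 * a (k+2) r + 2 * (k+2) * (r * a (k+1) r) + ((k:ℝ)+2)*(k+1) * a k r) = 0 := by
    intro k
    induction k with
    | zero =>
      refine key _ _ (fun r => ?_) h1
      refine HasDerivAt.congr_deriv ((((((hsq r).mul (ha 3 r)).add (((hid r).mul (ha 2 r)).const_mul 3)).add
        (ha 1 r)).add (hb 1 r)).add
        ((((hsq r).mul (ha 1 r)).add (((hid r).mul (ha 0 r)).const_mul 2)).const_mul lam)) ?_
      simp only [Nat.reduceAdd, zero_add, Nat.cast_zero]; ring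
    | succ k ih =>
      refine key _ _ (fun r => ?_) ih
      refine HasDerivAt.congr_deriv ((((((hsq r).mul (ha (k+4) r)).add
        (((hid r).mul (ha (k+3) r)).const_mul (2*(k:ℝ)+5))).add
        ((ha (k+2) r).const_mul (((k:ℝ)+2)^2))).add (hb (k+2) r)).add
        (((((hsq r).mul (ha (k+2) r)).add
          (((hid r).mul (ha (k+1) r)).const_mul (2*((k:ℝ)+2)))).add
          ((ha k r).const_mul (((k:ℝ)+2)*(k+1)))).const_mul lam)) ?_
      simp only [show k+1+4 = k+4+1 by ring, show k+1+3 = k+3+1 by ring,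
        show k+1+2=k+2+1 by ring]
      push_cast; ring
  have hz : |(0:ℝ)| < R := by simpa
  refine ⟨by simpa using h 0 hz, by simpa using h1 0 hz, fun k => ?_⟩
  simpa using h2 k 0 hz

/-- Flat solutions of the Bessel-type equation vanish. -/
lemma aux_bessel (a : ℕ → ℝ → ℝ) (R lam m : ℝ)
    (ha : ∀ k r, HasDerivAt (a k) (a (k+1) r) r)
    (h : ∀ r, |r| < R → r^2 * a 2 r + r * a 1 r - m * a 0 r + lam * (r^2 * a 0 r) = 0)
    (hz : ∀ j, a j 0 = 0) : ∀ r, 0 ≤ r → r < R → a 0 r = 0 := by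
  intro r hr0 hrR
  rcases hr0.eq_or_lt with rfl | hr
  · exact hz 0
  obtain ⟨M, hM⟩ := exists_nat_ge (1 + |m| + |lam| * R^2)
  obtain ⟨C0, hC0, h0⟩ := aux_flat a ha hz M r
  obtain ⟨C1, hC1, h1⟩ := aux_flat (fun k => a (k+1)) (fun k => ha (k+1))
    (fun j => hz (j+1)) M r
  set E : ℝ → ℝ := fun s => a 0 s ^ 2 + (s * a 1 s)^2 with hE
  have hEd : ∀ s, HasDerivAt E (2 * a 0 s * a 1 s + 2 * (s * a 1 s) * (a 1 s + s * a 2 s)) s := by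
    intro s
    have e1 := (ha 0 s).pow 2
    have e2 := ((hasDerivAt_id s).mul (ha 1 s)).pow 2
    refine (e1.add e2).congr_deriv ?_
    simp
  have hanti : AntitoneOn (fun s => E s / s ^ M) (Ioc 0 r) := by
    apply antitoneOn_of_hasDerivWithinAt_nonpos (convex_Ioc 0 r)
      (f' := fun s => ((2 * a 0 s * a 1 s + 2 * (s * a 1 s) * (a 1 s + s * a 2 s)) * s^M
        - E s * (M * s^(M-1))) / (s^M)^2)
    · intro s hs
      have hs0 : s ≠ 0 := hs.1.ne'
      exact ((hEd s).div (hasDerivAt_pow M s) (pow_ne_zero _ hs0)).continuousAt.continuousWithinAt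
    · intro s hs
      rw [interior_Ioc] at hs
      have hs0 : s ≠ 0 := hs.1.ne'
      exact ((hEd s).div (hasDerivAt_pow M s) (pow_ne_zero _ hs0)).hasDerivWithinAt
    · intro s hs
      rw [interior_Ioc] at hs
      have hs0 : 0 < s := hs.1
      apply div_nonpos_of_nonpos_of_nonneg _ (by positivity)
      have hM1 : M ≠ 0 := by
        rintro rfl
        have : (0:ℝ) ≤ |m| + |lam| * R^2 := by positivity
        simp at hM; linarith
      obtain ⟨M', rfl⟩ := Nat.exists_eq_succ_of_ne_zero hM1
      have heq := h s (by rw [abs_of_pos hs0]; exact hs.2.trans hrR)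
      have hkey : s * (2 * a 0 s * a 1 s + 2 * (s * a 1 s) * (a 1 s + s * a 2 s))
          ≤ (M'.succ : ℝ) * E s := by
        have e1 : s * (2 * a 0 s * a 1 s + 2 * (s * a 1 s) * (a 1 s + s * a 2 s))
          = 2 * (a 0 s) * (s * a 1 s) * (1 + m - lam * s^2) := by
            linear_combination (2 * (s * a 1 s)) * heq
        rw [e1]
        have hb : |1 + m - lam * s^2| ≤ (M'.succ : ℝ) := by
          refine le_trans ?_ hM
          have : |lam * s^2| ≤ |lam| * R^2 := by
            rw [abs_mul, abs_of_nonneg (sq_nonneg s)]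
            gcongr
            exact (hs.2.trans hrR).le
          calc |1 + m - lam * s^2| ≤ |1 + m| + |lam * s^2| := abs_sub _ _
            _ ≤ (|1| + |m|) + |lam| * R^2 := add_le_add (abs_add_le _ _) this
            _ = _ := by simp
        have hxy : |2 * (a 0 s) * (s * a 1 s)| ≤ E s := by
          rw [abs_le]; simp only [hE]
          constructor <;> nlinarith [sq_nonneg (a 0 s + s * a 1 s), sq_nonneg (a 0 s - s * a 1 s)]
        calc _ ≤ |2 * (a 0 s) * (s * a 1 s) * (1 + m - lam * s^2)| := le_abs_self _
          _ = |2 * (a 0 s) * (s * a 1 s)| * |1 + m - lam * s^2| := abs_mul _ _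
          _ ≤ E s * M'.succ := by gcongr
          _ = _ := mul_comm _ _
      have : 0 ≤ s^M' := by positivity
      have e3 : M'.succ - 1 = M' := by simp
      rw [e3, pow_succ]
      have := mul_le_mul_of_nonneg_left hkey this
      nlinarith
  have hbound : ∀ s ∈ Ioc 0 r, E r / r^M ≤ (C0^2 + r^2 * C1^2) * r^M * r * s := by
    intro s hs
    refine (hanti hs ⟨hr, le_rfl⟩ hs.2).trans ?_
    have hs0 : 0 < s := hs.1
    rw [div_le_iff₀ (by positivity)]
    have g0 := h0 s ⟨hs.1.le, hs.2⟩
    have g1 := h1 s ⟨hs.1.le, hs.2⟩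
    simp only [zero_add] at g1
    have q0 : a 0 s ^2 ≤ (C0 * s^(M+1))^2 := by
      rw [← sq_abs]; gcongr
    have q1 : a 1 s ^2 ≤ (C1 * s^(M+1))^2 := by
      rw [← sq_abs]; gcongr
    have q2 : s^2 * a 1 s^2 ≤ r^2 * (C1 * s^(M+1))^2 := by
      gcongr; exact hs.2
    have q3 : s^(M+1) ≤ r^M * r := by
      rw [← pow_succ]; gcongr; exact hs.2
    calc E s ≤ (C0 * s^(M+1))^2 + r^2 * (C1 * s^(M+1))^2 := by
          simp only [hE]; nlinarith
      _ = (C0^2 + r^2 * C1^2) * s^(M+1) * s^(M+1) := by ring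
      _ ≤ (C0^2 + r^2 * C1^2) * (r^M * r) * (s^(M+1)) := by gcongr
      _ = _ := by ring
  have hle : E r / r^M ≤ 0 := by
    set K := (C0^2 + r^2 * C1^2) * r^M * r with hK
    have hK0 : 0 ≤ K := by positivity
    by_contra hcon
    push Not at hcon
    set A := E r / r^M
    have hs1 : 0 < min r (A / (2 * (K + 1))) := by positivity
    have := hbound _ ⟨hs1, min_le_left _ _⟩
    have h4 : K * min r (A / (2 * (K + 1))) ≤ K * (A / (2 * (K+1))) :=
      mul_le_mul_of_nonneg_left (min_le_right _ _) hK0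
    have h5 : K * (A / (2 * (K+1))) < A := by
      rw [mul_div_assoc', div_lt_iff₀ (by positivity)]
      nlinarith
    linarith
  have hE0 : E r ≤ 0 := by
    have hp : 0 < r^M := by positivity
    by_contra hcon
    push Not at hcon
    have : 0 < E r / r^M := by positivity
    linarith
  have : a 0 r ^ 2 ≤ 0 := by
    simp only [hE] at hE0
    nlinarith [sq_nonneg (r * a 1 r)]
  nlinarith [pow_eq_zero_iff (two_ne_zero) |>.1 (le_antisymm this (sq_nonneg _))]

/-- Radial partial derivative. -/
def Dr (F : ℝ × ℝ → ℝ) : ℝ × ℝ → ℝ := fun z => fderiv ℝ F z (1, 0)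

/-- Angular partial derivative. -/
def Dt (F : ℝ × ℝ → ℝ) : ℝ × ℝ → ℝ := fun z => fderiv ℝ F z (0, 1)

/-- Iterated radial derivative. -/
def Drk (F : ℝ × ℝ → ℝ) : ℕ → ℝ × ℝ → ℝ
  | 0 => F
  | k + 1 => Dr (Drk F k)

lemma contDiff_dir {F : ℝ × ℝ → ℝ} (hF : ContDiff ℝ (⊤ : ℕ∞) F) (v : ℝ × ℝ) :
    ContDiff ℝ (⊤ : ℕ∞) (fun z => fderiv ℝ F z v) :=
  (hF.fderiv_right (m := (⊤ : ℕ∞)) (by simp)).clm_apply contDiff_const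

lemma contDiff_Dr {F : ℝ × ℝ → ℝ} (hF : ContDiff ℝ (⊤ : ℕ∞) F) : ContDiff ℝ (⊤ : ℕ∞) (Dr F) :=
  contDiff_dir hF _

lemma contDiff_Dt {F : ℝ × ℝ → ℝ} (hF : ContDiff ℝ (⊤ : ℕ∞) F) : ContDiff ℝ (⊤ : ℕ∞) (Dt F) :=
  contDiff_dir hF _

lemma contDiff_Drk {F : ℝ × ℝ → ℝ} (hF : ContDiff ℝ (⊤ : ℕ∞) F) (k : ℕ) :
    ContDiff ℝ (⊤ : ℕ∞) (Drk F k) := by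
  induction k with
  | zero => exact hF
  | succ k ih => exact contDiff_Dr ih

lemma hasDerivAt_r {F : ℝ × ℝ → ℝ} (hF : ContDiff ℝ (⊤ : ℕ∞) F) (r t : ℝ) :
    HasDerivAt (fun r => F (r, t)) (Dr F (r, t)) r := by
  have h1 : HasFDerivAt F (fderiv ℝ F (r, t)) (r, t) :=
    (hF.differentiable (by simp) _).hasFDerivAt
  have h2 : HasDerivAt (fun r : ℝ => (r, t)) ((1:ℝ), (0:ℝ)) r :=
    (hasDerivAt_id r).prodMk (hasDerivAt_const r t)
  exact h1.comp_hasDerivAt r h2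

lemma hasDerivAt_t {F : ℝ × ℝ → ℝ} (hF : ContDiff ℝ (⊤ : ℕ∞) F) (r t : ℝ) :
    HasDerivAt (fun t => F (r, t)) (Dt F (r, t)) t := by
  have h1 : HasFDerivAt F (fderiv ℝ F (r, t)) (r, t) :=
    (hF.differentiable (by simp) _).hasFDerivAt
  have h2 : HasDerivAt (fun t : ℝ => (r, t)) ((0:ℝ), (1:ℝ)) t :=
    (hasDerivAt_const t r).prodMk (hasDerivAt_id t)
  exact h1.comp_hasDerivAt t h2

lemma Dr_Dt_comm {F : ℝ × ℝ → ℝ} (hF : ContDiff ℝ (⊤ : ℕ∞) F) : Dr (Dt F) = Dt (Dr F) := by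
  have hd : Differentiable ℝ (fderiv ℝ F) :=
    (hF.fderiv_right (m := (⊤ : ℕ∞)) (by simp)).differentiable (by simp)
  have key : ∀ z v w, fderiv ℝ (fun y => fderiv ℝ F y v) z w = fderiv ℝ (fderiv ℝ F) z w v := by
    intro z v w
    have := (hd z).hasFDerivAt.clm_apply (hasFDerivAt_const v z)
    rw [this.fderiv]; simp
  funext z
  have hs : IsSymmSndFDerivAt ℝ F z :=
    hF.contDiffAt.isSymmSndFDerivAt (by simpa using WithTop.coe_le_coe.2 (le_top : (2:ℕ∞) ≤ ⊤))
  show fderiv ℝ (fun y => fderiv ℝ F y (0, 1)) z (1, 0) =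
    fderiv ℝ (fun y => fderiv ℝ F y (1, 0)) z (0, 1)
  rw [key, key, hs]

lemma Drk_Dt_comm {F : ℝ × ℝ → ℝ} (hF : ContDiff ℝ (⊤ : ℕ∞) F) (k : ℕ) :
    Drk (Dt F) k = Dt (Drk F k) := by
  induction k with
  | zero => rfl
  | succ k ih =>
    show Dr (Drk (Dt F) k) = Dt (Dr (Drk F k))
    rw [ih, Dr_Dt_comm (contDiff_Drk hF k)]

lemma hasDerivAt_Drk {F : ℝ × ℝ → ℝ} (hF : ContDiff ℝ (⊤ : ℕ∞) F) (t : ℝ) (k : ℕ) (r : ℝ) :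
    HasDerivAt (fun r => Drk F k (r, t)) (Drk F (k+1) (r, t)) r :=
  hasDerivAt_r (contDiff_Drk hF k) r t

lemma periodic_Dt {F : ℝ × ℝ → ℝ} (hF : ContDiff ℝ (⊤ : ℕ∞) F) (T : ℝ)
    (hp : ∀ r t, F (r, t + T) = F (r, t)) (r t : ℝ) : Dt F (r, t + T) = Dt F (r, t) := by
  have h1 : HasDerivAt (fun t => F (r, t + T)) (Dt F (r, t + T)) t :=
    (hasDerivAt_t hF r (t + T)).comp_add_const t T
  have h2 : (fun t => F (r, t + T)) = fun t => F (r, t) := funext fun t => hp r t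
  rw [h2] at h1
  exact h1.unique (hasDerivAt_t hF r t)

/-- Angular integral against a weight. -/
def Ie (e : ℝ → ℝ) (F : ℝ × ℝ → ℝ) (r : ℝ) : ℝ :=
  ∫ t in (0:ℝ)..(2 * Real.pi), F (r, t) * e t

lemma hasDerivAt_Ie {e : ℝ → ℝ} (he : Continuous e) {F : ℝ × ℝ → ℝ}
    (hF : ContDiff ℝ (⊤ : ℕ∞) F) (r : ℝ) : HasDerivAt (Ie e F) (Ie e (Dr F) r) r := by
  have hFc := hF.continuous
  have hDc := (contDiff_Dr hF).continuous
  obtain ⟨C, hC⟩ := ((isCompact_Icc (a := r - 1) (b := r + 1)).prod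
    (isCompact_Icc (a := (0:ℝ)) (b := 2 * Real.pi))).exists_bound_of_continuousOn
    (f := fun z : ℝ × ℝ => Dr F z * e z.2) (by fun_prop)
  refine (intervalIntegral.hasDerivAt_integral_of_dominated_loc_of_deriv_le
    (F := fun r t => F (r, t) * e t) (F' := fun r t => Dr F (r, t) * e t)
    (bound := fun _ => C) (s := Icc (r - 1) (r + 1))
    (Icc_mem_nhds (by linarith) (by linarith)) ?_ ?_ ?_ ?_ ?_ ?_).2
  · refine Filter.Eventually.of_forall fun x => Continuous.aestronglyMeasurable (by fun_prop)
  · exact Continuous.intervalIntegrable (by fun_prop) _ _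
  · exact Continuous.aestronglyMeasurable (by fun_prop)
  · refine Filter.Eventually.of_forall fun t ht x hx => ?_
    rw [uIoc_of_le (by positivity)] at ht
    exact hC (x, t) ⟨hx, ht.1.le, ht.2⟩
  · exact intervalIntegrable_const
  · refine Filter.Eventually.of_forall fun t _ x _ => (hasDerivAt_r hF x t).mul_const _

lemma Ie_DtDt {e e' : ℝ → ℝ} (m : ℝ) (he : ∀ t, HasDerivAt e (e' t) t)
    (he' : ∀ t, HasDerivAt e' (- m * e t) t)
    (hep : e (2 * Real.pi) = e 0) (hep' : e' (2 * Real.pi) = e' 0)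
    {F : ℝ × ℝ → ℝ} (hF : ContDiff ℝ (⊤ : ℕ∞) F)
    (hp : ∀ r t, F (r, t + 2 * Real.pi) = F (r, t)) (r : ℝ) :
    Ie e (Dt (Dt F)) r = - m * Ie e F r := by
  have hFc := hF.continuous
  have hDc := (contDiff_Dt hF).continuous
  have hDDc := (contDiff_Dt (contDiff_Dt hF)).continuous
  have hec : Continuous e := continuous_iff_continuousAt.2 fun t => (he t).continuousAt
  have hec' : Continuous e' := continuous_iff_continuousAt.2 fun t => (he' t).continuousAt
  have p0 : F (r, 2 * Real.pi) = F (r, 0) := by simpa using hp r 0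
  have p1 : Dt F (r, 2 * Real.pi) = Dt F (r, 0) := by
    simpa using periodic_Dt hF _ hp r 0
  have hd : ∀ t, HasDerivAt (fun t => Dt F (r, t) * e t - F (r, t) * e' t)
      (Dt (Dt F) (r, t) * e t + m * (F (r, t) * e t)) t := by
    intro t
    refine (((hasDerivAt_t (contDiff_Dt hF) r t).mul (he t)).sub
      ((hasDerivAt_t hF r t).mul (he' t))).congr_deriv ?_
    ring
  have h1 := intervalIntegral.integral_eq_sub_of_hasDerivAt (a := 0) (b := 2 * Real.pi)
    (fun t _ => hd t) (Continuous.intervalIntegrable (by fun_prop) _ _)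
  rw [intervalIntegral.integral_add (Continuous.intervalIntegrable (by fun_prop) _ _)
    (Continuous.intervalIntegrable (by fun_prop) _ _),
    intervalIntegral.integral_const_mul, p0, p1, hep, hep'] at h1
  unfold Ie
  linarith

/-- The polar form of the eigenvalue equation, on `|r| < R`. -/
structure PolarSol (F : ℝ × ℝ → ℝ) (R lam : ℝ) : Prop where
  smooth : ContDiff ℝ (⊤ : ℕ∞) F
  per : ∀ r t, F (r, t + 2 * Real.pi) = F (r, t)
  pos : 0 < R
  eqn : ∀ r t, |r| < R → r^2 * Drk F 2 (r, t) + r * Drk F 1 (r, t) + Dt (Dt F) (r, t)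
    + lam * (r^2 * F (r, t)) = 0

lemma PolarSol.ode {F : ℝ × ℝ → ℝ} {R lam : ℝ} (h : PolarSol F R lam)
    {e e' : ℝ → ℝ} (m : ℝ) (he : ∀ t, HasDerivAt e (e' t) t)
    (he' : ∀ t, HasDerivAt e' (- m * e t) t)
    (hep : e (2 * Real.pi) = e 0) (hep' : e' (2 * Real.pi) = e' 0) (r : ℝ) (hr : |r| < R) :
    r^2 * Ie e (Drk F 2) r + r * Ie e (Drk F 1) r - m * Ie e F r
      + lam * (r^2 * Ie e F r) = 0 := by
  have h0 := Ie_DtDt m he he' hep hep' h.smooth h.per r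
  have hec : Continuous e := continuous_iff_continuousAt.2 fun t => (he t).continuousAt
  have c0 := h.smooth.continuous
  have c1 := (contDiff_Drk h.smooth 1).continuous
  have c2 := (contDiff_Drk h.smooth 2).continuous
  have c3 := (contDiff_Dt (contDiff_Dt h.smooth)).continuous
  have h1 : ∫ t in (0:ℝ)..(2 * Real.pi), (r^2 * (Drk F 2 (r, t) * e t)
      + r * (Drk F 1 (r, t) * e t) + Dt (Dt F) (r, t) * e t
      + lam * r^2 * (F (r, t) * e t)) = 0 := by
    rw [intervalIntegral.integral_congr (g := fun _ => (0:ℝ))]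
    · simp
    · intro t _
      simp only
      linear_combination (e t) * h.eqn r t hr
  rw [intervalIntegral.integral_add (Continuous.intervalIntegrable (by fun_prop) _ _)
    (Continuous.intervalIntegrable (by fun_prop) _ _),
    intervalIntegral.integral_add (Continuous.intervalIntegrable (by fun_prop) _ _)
    (Continuous.intervalIntegrable (by fun_prop) _ _),
    intervalIntegral.integral_add (Continuous.intervalIntegrable (by fun_prop) _ _)
    (Continuous.intervalIntegrable (by fun_prop) _ _),
    intervalIntegral.integral_const_mul, intervalIntegral.integral_const_mul,
    intervalIntegral.integral_const_mul] at h1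
  unfold Ie at h0 ⊢
  linarith

lemma hasDerivAt_Ie_Drk {e : ℝ → ℝ} (he : Continuous e) {F : ℝ × ℝ → ℝ}
    (hF : ContDiff ℝ (⊤ : ℕ∞) F) (k : ℕ) (r : ℝ) :
    HasDerivAt (Ie e (Drk F k)) (Ie e (Drk F (k+1)) r) r :=
  hasDerivAt_Ie he (contDiff_Drk hF k) r

/-- Vanishing of circle averages when the value at the centre is zero. -/
lemma PolarSol.mean_zero {F : ℝ × ℝ → ℝ} {R lam : ℝ} (h : PolarSol F R lam)
    (h0 : ∀ t, F (0, t) = 0) (r : ℝ) (hr0 : 0 ≤ r) (hr : r < R) :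
    ∫ t in (0:ℝ)..(2 * Real.pi), F (r, t) = 0 := by
  have hode := h.ode (e := fun _ => 1) (e' := fun _ => 0) 0 (fun t => hasDerivAt_const t 1)
    (fun t => by simpa using hasDerivAt_const t (0:ℝ)) rfl rfl
  have hd := hasDerivAt_Ie_Drk (e := fun _ => 1) continuous_const h.smooth
  have hz0 : Ie (fun _ => 1) (Drk F 0) 0 = 0 := by simp [Ie, Drk, h0]
  have hs := aux_seq (fun k => Ie (fun _ => 1) (Drk F k)) (fun _ _ => 0) R lam h.pos hd
    (fun k r => hasDerivAt_const r 0) (fun r hr => by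
      have := hode r hr
      simp only [Drk] at this ⊢; linarith)
  have hz : ∀ j, Ie (fun _ => 1) (Drk F j) 0 = 0 := by
    intro j
    induction j using Nat.strong_induction_on with
    | _ j ih =>
      match j, ih with
      | 0, _ => exact hz0
      | 1, _ => simpa using hs.2.1
      | k+2, ih =>
        have := hs.2.2 k
        simp only [ih k (by omega), mul_zero, add_zero] at this
        rcases mul_eq_zero.1 this with h' | h'
        · have h9 : ((k:ℝ) + 2)^2 > 0 := by positivity
          exact absurd h9 (by rw [h']; simp)
        · exact h'
  have := aux_bessel (fun k => Ie (fun _ => 1) (Drk F k)) R lam 0 hd hode hz r hr0 hr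
  simpa [Ie, Drk] using this

/-- A continuous periodic function with vanishing Fourier coefficients is zero. -/
lemma aux_fourier (g : ℝ → ℝ) (hg : Continuous g) (hp : ∀ t, g (t + 2 * Real.pi) = g t)
    (hc : ∀ n : ℤ, ∫ t in (0:ℝ)..(2 * Real.pi), g t * Real.cos (n * t) = 0)
    (hs : ∀ n : ℤ, ∫ t in (0:ℝ)..(2 * Real.pi), g t * Real.sin (n * t) = 0) (t : ℝ) :
    g t = 0 := by
  have : Fact (0 < 2 * Real.pi) := ⟨by positivity⟩
  have hper : Function.Periodic (fun t => (g t : ℂ)) (2 * Real.pi) := fun t => by simp [hp]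
  have hcont : Continuous (hper.lift : AddCircle (2 * Real.pi) → ℂ) := by
    apply continuous_coinduced_dom.mpr
    exact Complex.continuous_ofReal.comp hg
  let f : C(AddCircle (2 * Real.pi), ℂ) := ⟨hper.lift, hcont⟩
  have hcoef : ∀ n : ℤ, fourierCoeff f n = 0 := by
    intro n
    rw [fourierCoeff_eq_intervalIntegral _ _ 0]
    have e1 : ∀ x : ℝ, fourier (-n) (x : AddCircle (2 * Real.pi)) • f x
        = ((g x * Real.cos (n * x) : ℝ) : ℂ) - Complex.I * ((g x * Real.sin (n * x) : ℝ) : ℂ) := by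
      intro x
      have : f x = (g x : ℂ) := hper.lift_coe x
      rw [this, fourier_coe_apply]
      have hpi : (Real.pi : ℂ) ≠ 0 := by exact_mod_cast Real.pi_ne_zero
      have : (2 * (Real.pi:ℂ) * Complex.I * ((-n : ℤ) : ℂ) * x / ((2 * Real.pi : ℝ) : ℂ))
          = ((-(n * x) : ℝ) : ℂ) * Complex.I := by
        push_cast; field_simp
      rw [this, Complex.exp_mul_I, ← Complex.ofReal_cos, ← Complex.ofReal_sin,
        Real.cos_neg, Real.sin_neg, smul_eq_mul]
      push_cast; ring
    simp_rw [e1]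
    rw [intervalIntegral.integral_sub (Continuous.intervalIntegrable (by fun_prop) _ _)
      (Continuous.intervalIntegrable (by fun_prop) _ _), intervalIntegral.integral_const_mul,
      intervalIntegral.integral_ofReal, intervalIntegral.integral_ofReal, zero_add, hc, hs]
    simp
  have hsum : Summable (fourierCoeff f) := by
    have : fourierCoeff f = fun _ => 0 := funext hcoef
    rw [this]; exact summable_zero
  have h1 := has_pointwise_sum_fourier_series_of_summable hsum (t : AddCircle (2 * Real.pi))
  simp only [hcoef, zero_smul] at h1
  have h2 : f (t : AddCircle (2 * Real.pi)) = 0 := h1.unique hasSum_zero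
  have h3 : f (t : AddCircle (2 * Real.pi)) = (g t : ℂ) := hper.lift_coe t
  rw [h3] at h2
  exact_mod_cast h2

/-- Strong unique continuation in polar form. -/
lemma PolarSol.suc {F : ℝ × ℝ → ℝ} {R lam : ℝ} (h : PolarSol F R lam)
    (hz : ∀ k t, Drk F k (0, t) = 0) (r : ℝ) (hr0 : 0 ≤ r) (hr : r < R) (t : ℝ) :
    F (r, t) = 0 := by
  have hFc := h.smooth.continuous
  have gen : ∀ (e e' : ℝ → ℝ) (m : ℝ), (∀ t, HasDerivAt e (e' t) t) →
      (∀ t, HasDerivAt e' (- m * e t) t) → e (2 * Real.pi) = e 0 → e' (2 * Real.pi) = e' 0 →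
      ∫ t in (0:ℝ)..(2 * Real.pi), F (r, t) * e t = 0 := by
    intro e e' m he he' hep hep'
    have hec : Continuous e := continuous_iff_continuousAt.2 fun t => (he t).continuousAt
    exact aux_bessel (fun k => Ie e (Drk F k)) R lam m (hasDerivAt_Ie_Drk hec h.smooth)
      (h.ode m he he' hep hep') (fun j => by simp [Ie, hz]) r hr0 hr
  have hl : ∀ (n : ℤ) (t : ℝ), HasDerivAt (fun t : ℝ => (n:ℝ) * t) n t := fun n t => by
    simpa using (hasDerivAt_id t).const_mul (n:ℝ)
  have c1 : ∀ n : ℤ, Real.cos (n * (2 * Real.pi)) = 1 := fun n => Real.cos_int_mul_two_pi n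
  have s1 : ∀ n : ℤ, Real.sin (n * (2 * Real.pi)) = 0 := fun n => by
    have := Real.sin_int_mul_pi (n * 2)
    push_cast at this
    rw [← this]; ring_nf
  refine aux_fourier (fun t => F (r, t)) (by fun_prop) (fun t => h.per r t) (fun n => ?_)
    (fun n => ?_) t
  · refine gen (fun t => Real.cos (n * t)) (fun t => - n * Real.sin (n * t)) ((n:ℝ)^2)
      (fun t => ?_) (fun t => ?_) (by simp [c1]) (by simp [s1])
    · exact (hl n t).cos.congr_deriv (by ring)
    · exact ((hl n t).sin.const_mul (-(n:ℝ))).congr_deriv (by ring)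
  · refine gen (fun t => Real.sin (n * t)) (fun t => n * Real.cos (n * t)) ((n:ℝ)^2)
      (fun t => ?_) (fun t => ?_) (by simp [s1]) (by simp [c1])
    · exact (hl n t).sin.congr_deriv (by ring)
    · exact ((hl n t).cos.const_mul (n:ℝ)).congr_deriv (by ring)

/-- Uniform Taylor estimate. -/
lemma aux_unif_taylor {F : ℝ × ℝ → ℝ} (hF : ContDiff ℝ (⊤ : ℕ∞) F) (N : ℕ)
    (hz : ∀ j < N, ∀ t, Drk F j (0, t) = 0) :
    ∃ C, 0 ≤ C ∧ ∀ r ∈ Icc (0:ℝ) 1, ∀ t ∈ Icc (-Real.pi) Real.pi,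
      |F (r, t) - Drk F N (0, t) * r ^ N / (N.factorial : ℝ)| ≤ C * r ^ (N+1) := by
  obtain ⟨C, hC⟩ := ((isCompact_Icc (a := (0:ℝ)) (b := 1)).prod
    (isCompact_Icc (a := -Real.pi) (b := Real.pi))).exists_bound_of_continuousOn
    (f := Drk F (N+1)) (contDiff_Drk hF _).continuous.continuousOn
  refine ⟨max C 0, le_max_right _ _, fun r hr t ht => ?_⟩
  exact aux_taylor N (fun k r => Drk F k (r, t)) (max C 0) 1 (hasDerivAt_Drk hF t)
    (fun j hj => hz j hj t) (fun s hs => (hC (s, t) ⟨hs, ht⟩).trans (le_max_left _ _)) r hr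

/-- Isolation of critical zeros in polar form. -/
lemma PolarSol.isolated {F : ℝ × ℝ → ℝ} {R lam : ℝ} (h : PolarSol F R lam)
    (h0 : ∀ t, F (0, t) = 0) (hne : ∃ k t, Drk F k (0, t) ≠ 0) :
    ∃ δ > 0, ∀ r t, 0 < r → r < δ → t ∈ Icc (-Real.pi) Real.pi →
      ¬ (F (r, t) = 0 ∧ Dt F (r, t) = 0) := by
  classical
  have hF := h.smooth
  set N := Nat.find hne with hN
  obtain ⟨t0, ht0⟩ : ∃ t, Drk F N (0, t) ≠ 0 := Nat.find_spec hne
  have hmin : ∀ j < N, ∀ t, Drk F j (0, t) = 0 := by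
    intro j hj t
    by_contra hcon
    exact Nat.find_min hne hj ⟨t, hcon⟩
  have hN0 : N ≠ 0 := by
    intro h'
    rw [h'] at ht0
    exact ht0 (h0 t0)
  have hminT : ∀ j < N, ∀ t, Drk (Dt F) j (0, t) = 0 := by
    intro j hj t
    rw [Drk_Dt_comm hF]
    have h1 := hasDerivAt_t (contDiff_Drk hF j) 0 t
    have h2 : (fun t => Drk F j (0, t)) = fun _ => 0 := funext (hmin j hj)
    rw [h2] at h1
    exact h1.unique (hasDerivAt_const t 0)
  obtain ⟨C, hC, hT⟩ := aux_unif_taylor hF N hmin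
  obtain ⟨C', hC', hT'⟩ := aux_unif_taylor (contDiff_Dt hF) N hminT
  set P : ℝ → ℝ := fun t => Drk F N (0, t) with hP
  set P' : ℝ → ℝ := fun t => Drk (Dt F) N (0, t) with hP'
  have dP : ∀ t, HasDerivAt P (P' t) t := by
    intro t
    simp only [hP', Drk_Dt_comm hF]
    exact hasDerivAt_t (contDiff_Drk hF N) 0 t
  have dP' : ∀ t, HasDerivAt P' (-(N:ℝ)^2 * P t) t := by
    intro t
    have h1 := hasDerivAt_t (contDiff_Drk (contDiff_Dt hF) N) 0 t
    rw [← Drk_Dt_comm (contDiff_Dt hF)] at h1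
    refine h1.congr_deriv ?_
    have hs := aux_seq (fun k r => Drk F k (r, t)) (fun k r => Drk (Dt (Dt F)) k (r, t)) R lam
      h.pos (hasDerivAt_Drk hF t) (hasDerivAt_Drk (contDiff_Dt (contDiff_Dt hF)) t)
      (fun r hr => h.eqn r t hr)
    simp only [hP]
    clear_value N
    match N, hN0, hmin with
    | 1, _, _ => have := hs.2.1; push_cast; linarith
    | k+2, _, hmin =>
      have := hs.2.2 k
      simp only [hmin k (by omega) t] at this
      push_cast; linarith
  set c := (N:ℝ)^2 * P t0 ^ 2 + P' t0 ^ 2 with hc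
  have hconst : ∀ t, (N:ℝ)^2 * P t ^ 2 + P' t ^ 2 = c := by
    intro t
    have hd : ∀ t, HasDerivAt (fun t => (N:ℝ)^2 * P t ^ 2 + P' t ^ 2) 0 t := by
      intro t
      refine ((((dP t).pow 2).const_mul ((N:ℝ)^2)).add ((dP' t).pow 2)).congr_deriv ?_
      push_cast; ring
    exact is_const_of_deriv_eq_zero (fun t => (hd t).differentiableAt)
      (fun t => (hd t).deriv) t t0
  have hcpos : 0 < c := by
    have : 0 < P t0 ^ 2 := by positivity
    positivity
  set A : ℝ := (N.factorial : ℝ) with hA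
  have hApos : 0 < A := by positivity
  set K := (N:ℝ)^2 * (C * A)^2 + (C' * A)^2 with hK
  have hK0 : 0 ≤ K := by positivity
  refine ⟨min 1 (c / (K + 1)), by positivity, ?_⟩
  rintro r t hr hrδ ht ⟨hz1, hz2⟩
  have hr1 : r < 1 := hrδ.trans_le (min_le_left _ _)
  have hr2 : r < c / (K + 1) := hrδ.trans_le (min_le_right _ _)
  have red : ∀ (D x : ℝ), |0 - x * r ^ N / A| ≤ D * r ^ (N+1) → |x| ≤ D * A * r := by
    intro D x hx
    have hrN : 0 < r^N := by positivity
    rw [zero_sub, abs_neg, abs_div, abs_mul, abs_of_pos hrN, abs_of_pos hApos,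
      div_le_iff₀ hApos, pow_succ] at hx
    refine le_of_mul_le_mul_right (a := r^N) ?_ hrN
    nlinarith
  have q1 := red C (P t) (by simpa [hz1] using hT r ⟨hr.le, hr1.le⟩ t ht)
  have q2 := red C' (P' t) (by simpa [hz2] using hT' r ⟨hr.le, hr1.le⟩ t ht)
  have w1 : P t ^2 ≤ (C * A * r)^2 := by rw [← sq_abs]; gcongr
  have w2 : P' t ^2 ≤ (C' * A * r)^2 := by rw [← sq_abs]; gcongr
  have w3 : (N:ℝ)^2 * P t ^2 ≤ (N:ℝ)^2 * (C * A * r)^2 := by gcongr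
  have w4 : c ≤ K * r^2 := by
    rw [← hconst t, hK]; nlinarith
  have w5 : K * r^2 ≤ K * r := by
    have : r^2 ≤ r := by nlinarith
    gcongr
  rw [lt_div_iff₀ (by positivity)] at hr2
  nlinarith

/-- Zeros on each small circle in polar form. -/
lemma PolarSol.exists_zero {F : ℝ × ℝ → ℝ} {R lam : ℝ} (h : PolarSol F R lam)
    (h0 : ∀ t, F (0, t) = 0) (r : ℝ) (hr0 : 0 ≤ r) (hr : r < R) : ∃ t, F (r, t) = 0 := by
  have hFc := h.smooth.continuous
  have hm := h.mean_zero h0 r hr0 hr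
  have hc : Continuous fun t => F (r, t) := by fun_prop
  by_contra hcon
  push Not at hcon
  have hsign : (∀ t, 0 < F (r, t)) ∨ (∀ t, F (r, t) < 0) := by
    by_contra hs
    push Not at hs
    obtain ⟨⟨a, ha⟩, ⟨b, hb⟩⟩ := hs
    obtain ⟨t, ht⟩ := mem_range_of_exists_le_of_exists_ge hc ⟨a, ha⟩ ⟨b, hb⟩
    exact hcon t ht
  rcases hsign with hs | hs
  · have := intervalIntegral.intervalIntegral_pos_of_pos (a := 0) (b := 2 * Real.pi)
      (hc.intervalIntegrable _ _) hs (by positivity)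
    linarith
  · have := intervalIntegral.intervalIntegral_pos_of_pos (a := 0) (b := 2 * Real.pi)
      (f := fun t => - F (r, t))
      (hc.neg.intervalIntegrable _ _) (fun t => by simpa using hs t) (by positivity)
    rw [intervalIntegral.integral_neg] at this
    linarith

/-- Polar coordinates around `p`. -/
def pol (p : E2) (z : ℝ × ℝ) : E2 :=
  p + ((z.1 * Real.cos z.2) • (EuclideanSpace.single 0 1 : E2)
    + (z.1 * Real.sin z.2) • (EuclideanSpace.single 1 1 : E2))

lemma contDiff_pol (p : E2) : ContDiff ℝ (⊤ : ℕ∞) (pol p) := by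
  unfold pol; fun_prop

lemma dist_pol (p : E2) (r t : ℝ) : dist (pol p (r, t)) p = |r| := by
  have : dist (pol p (r, t)) p ^ 2 = r ^ 2 := by
    rw [dist_eq_norm, EuclideanSpace.real_norm_sq_eq]
    simp [pol, Fin.sum_univ_two]
    nlinarith [Real.sin_sq_add_cos_sq t]
  rw [← abs_of_nonneg (dist_nonneg (x := pol p (r, t)) (y := p))]
  exact (sq_eq_sq_iff_abs_eq_abs _ _).1 this

lemma exists_pol (p z : E2) : ∃ r t, 0 ≤ r ∧ t ∈ Icc (-Real.pi) Real.pi ∧ pol p (r, t) = z := by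
  set w : ℂ := ⟨z 0 - p 0, z 1 - p 1⟩ with hw
  refine ⟨‖w‖, w.arg, norm_nonneg _, ⟨(Complex.neg_pi_lt_arg w).le, Complex.arg_le_pi w⟩, ?_⟩
  have h1 := Complex.norm_mul_cos_arg w
  have h2 := Complex.norm_mul_sin_arg w
  ext i
  fin_cases i
  · simp [pol, hw]
  · simp [pol, hw]

lemma pol_hasDerivAt_r (p : E2) (g : E2 → ℝ) (hg : ContDiff ℝ (⊤ : ℕ∞) g) (r t : ℝ) :
    HasDerivAt (fun r => g (pol p (r, t)))
      (Real.cos t * fderiv ℝ g (pol p (r, t)) (EuclideanSpace.single 0 1)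
        + Real.sin t * fderiv ℝ g (pol p (r, t)) (EuclideanSpace.single 1 1)) r := by
  have h1 : HasFDerivAt g (fderiv ℝ g (pol p (r, t))) (pol p (r, t)) :=
    (hg.differentiable (by simp) _).hasFDerivAt
  have h2 : HasDerivAt (fun r : ℝ => pol p (r, t))
      ((1 * Real.cos t) • (EuclideanSpace.single 0 1 : E2)
        + (1 * Real.sin t) • (EuclideanSpace.single 1 1 : E2)) r :=
    (((hasDerivAt_id r).mul_const (Real.cos t)).smul_const _ |>.add
      (((hasDerivAt_id r).mul_const (Real.sin t)).smul_const _)).const_add p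
  refine (h1.comp_hasDerivAt r h2).congr_deriv ?_
  simp

lemma pol_hasDerivAt_t (p : E2) (g : E2 → ℝ) (hg : ContDiff ℝ (⊤ : ℕ∞) g) (r t : ℝ) :
    HasDerivAt (fun t => g (pol p (r, t)))
      (r * (-Real.sin t * fderiv ℝ g (pol p (r, t)) (EuclideanSpace.single 0 1)
        + Real.cos t * fderiv ℝ g (pol p (r, t)) (EuclideanSpace.single 1 1))) t := by
  have h1 : HasFDerivAt g (fderiv ℝ g (pol p (r, t))) (pol p (r, t)) :=
    (hg.differentiable (by simp) _).hasFDerivAt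
  have h2 : HasDerivAt (fun t : ℝ => pol p (r, t))
      ((r * -Real.sin t) • (EuclideanSpace.single 0 1 : E2)
        + (r * Real.cos t) • (EuclideanSpace.single 1 1 : E2)) t :=
    (((Real.hasDerivAt_cos t).const_mul r).smul_const _ |>.add
      (((Real.hasDerivAt_sin t).const_mul r).smul_const _)).const_add p
  refine (h1.comp_hasDerivAt t h2).congr_deriv ?_
  simp; ring

lemma polarSol_of_global (p : E2) (u : E2 → ℝ) (hu : ContDiff ℝ (⊤ : ℕ∞) u) (R lam : ℝ)
    (hR : 0 < R) (heq : ∀ z ∈ Metric.ball p R, negLap u z = lam * u z) :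
    PolarSol (fun z => u (pol p z)) R lam := by
  have hF : ContDiff ℝ (⊤ : ℕ∞) (fun z => u (pol p z)) := hu.comp (contDiff_pol p)
  have hdir : ∀ v : E2, ContDiff ℝ (⊤ : ℕ∞) (fun z => fderiv ℝ u z v) := fun v =>
    (hu.fderiv_right (m := (⊤ : ℕ∞)) (by simp)).clm_apply contDiff_const
  set a : E2 → ℝ := fun z => fderiv ℝ u z (EuclideanSpace.single 0 1) with ha
  set b : E2 → ℝ := fun z => fderiv ℝ u z (EuclideanSpace.single 1 1) with hb
  have ha' : ContDiff ℝ (⊤ : ℕ∞) a := hdir _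
  have hb' : ContDiff ℝ (⊤ : ℕ∞) b := hdir _
  refine ⟨hF, fun r t => by simp [pol], hR, fun r t hr => ?_⟩
  have e1 : ∀ r t, Dr (fun z => u (pol p z)) (r, t) =
      Real.cos t * a (pol p (r, t)) + Real.sin t * b (pol p (r, t)) := fun r t =>
    (hasDerivAt_r hF r t).unique (pol_hasDerivAt_r p u hu r t)
  have e2 : ∀ r t, Dt (fun z => u (pol p z)) (r, t) =
      r * (-Real.sin t * a (pol p (r, t)) + Real.cos t * b (pol p (r, t))) := fun r t =>
    (hasDerivAt_t hF r t).unique (pol_hasDerivAt_t p u hu r t)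
  have h3 := hasDerivAt_r (contDiff_Dr hF) r t
  simp only [e1] at h3
  have e3 := h3.unique (((pol_hasDerivAt_r p a ha' r t).const_mul (Real.cos t)).add
    ((pol_hasDerivAt_r p b hb' r t).const_mul (Real.sin t)))
  have h4 := hasDerivAt_t (contDiff_Dt hF) r t
  simp only [e2] at h4
  have e4 := h4.unique ((((Real.hasDerivAt_sin t).neg.mul (pol_hasDerivAt_t p a ha' r t)).add
    ((Real.hasDerivAt_cos t).mul (pol_hasDerivAt_t p b hb' r t))).const_mul r)
  have hpde := heq (pol p (r, t)) (by rw [Metric.mem_ball, dist_pol]; exact hr)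
  unfold negLap mixedDeriv at hpde
  simp only [Drk, e3, e4, e1]
  have hcs := Real.sin_sq_add_cos_sq t
  change -(fderiv ℝ a (pol p (r, t)) (EuclideanSpace.single 0 1)
    + fderiv ℝ b (pol p (r, t)) (EuclideanSpace.single 1 1)) = _ at hpde
  simp only [Pi.neg_apply]
  generalize fderiv ℝ a (pol p (r, t)) (EuclideanSpace.single 0 1) = ax at *
  generalize fderiv ℝ b (pol p (r, t)) (EuclideanSpace.single 1 1) = bY at *
  linear_combination (r^2 * (ax + bY)) * hcs - r^2 * hpde

/-- Local polar representation of the eigenfunction. -/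
lemma local_polar (Ω : Set E2) (hΩ : IsOpen Ω) (φ : E2 → ℝ) (lam : ℝ)
    (hsmooth : ContDiffOn ℝ (⊤ : ℕ∞) φ Ω) (heqn : ∀ z ∈ Ω, negLap φ z = lam * φ z)
    (p : E2) (R : ℝ) (hR : 0 < R) (hball : Metric.ball p R ⊆ Ω) (ρ : ℝ) (hρ : 0 < ρ)
    (hρR : ρ < R) :
    ∃ u : E2 → ℝ, ContDiff ℝ (⊤ : ℕ∞) u ∧ (∀ z ∈ Metric.ball p ρ, u z = φ z) ∧
      PolarSol (fun z => u (pol p z)) ρ lam := by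
  let χ : ContDiffBump p := ⟨ρ, (ρ + R) / 2, hρ, by linarith⟩
  set u : E2 → ℝ := fun z => χ z * φ z with hu
  have hone : ∀ z ∈ Metric.ball p ρ, u z = φ z := by
    intro z hz
    have : χ z = 1 := χ.one_of_mem_closedBall (Metric.ball_subset_closedBall hz)
    simp [hu, this]
  have hsm : ContDiff ℝ (⊤ : ℕ∞) u := by
    rw [contDiff_iff_contDiffAt]
    intro z
    by_cases hz : z ∈ Metric.ball p R
    · exact χ.contDiff.contDiffAt.mul (hsmooth.contDiffAt (hΩ.mem_nhds (hball hz)))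
    · have hz' : z ∈ (Metric.closedBall p ((ρ + R) / 2))ᶜ := by
        simp only [Metric.mem_ball, not_lt] at hz
        simp only [mem_compl_iff, Metric.mem_closedBall, not_le]
        linarith
      have : u =ᶠ[nhds z] fun _ => 0 := by
        filter_upwards [Metric.isClosed_closedBall.isOpen_compl.mem_nhds hz'] with y hy
        have : χ y = 0 := χ.zero_of_le_dist (by
          simp only [mem_compl_iff, Metric.mem_closedBall, not_le] at hy
          exact hy.le)
        simp [hu, this]
      exact contDiffAt_const.congr_of_eventuallyEq this
  refine ⟨u, hsm, hone, polarSol_of_global p u hsm ρ lam hρ fun z hz => ?_⟩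
  have hzΩ : z ∈ Ω := hball (Metric.ball_subset_ball hρR.le hz)
  rw [hone z hz, ← heqn z hzΩ]
  have hev : ∀ y ∈ Metric.ball p ρ, u =ᶠ[nhds y] φ := fun y hy => by
    filter_upwards [Metric.isOpen_ball.mem_nhds hy] with w hw using hone w hw
  have hmd : ∀ v w, mixedDeriv u z v w = mixedDeriv φ z v w := by
    intro v w
    unfold mixedDeriv
    have : (fun y => fderiv ℝ u y v) =ᶠ[nhds z] fun y => fderiv ℝ φ y v := by
      filter_upwards [Metric.isOpen_ball.mem_nhds hz] with y hy
      rw [(hev y hy).fderiv_eq]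
    rw [this.fderiv_eq]
  unfold negLap
  rw [hmd, hmd]

lemma Drk_zero_of_eventually (F : ℝ × ℝ → ℝ) (U : Set (ℝ × ℝ)) (hU : IsOpen U)
    (h0 : ∀ z ∈ U, F z = 0) (k : ℕ) : ∀ z ∈ U, Drk F k z = 0 := by
  induction k with
  | zero => exact h0
  | succ k ih =>
    intro z hz
    have : Drk F k =ᶠ[nhds z] fun _ => 0 := by
      filter_upwards [hU.mem_nhds hz] with y hy using ih y hy
    show fderiv ℝ (Drk F k) z (1, 0) = 0
    rw [this.fderiv_eq]; simp

/-- Unique continuation on balls. -/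
lemma zero_on_ball (Ω : Set E2) (hΩ : IsOpen Ω) (φ : E2 → ℝ) (lam : ℝ)
    (hsmooth : ContDiffOn ℝ (⊤ : ℕ∞) φ Ω) (heqn : ∀ z ∈ Ω, negLap φ z = lam * φ z)
    (p : E2) (R : ℝ) (hball : Metric.ball p R ⊆ Ω)
    (h0 : φ =ᶠ[nhds p] fun _ => 0) : ∀ z ∈ Metric.ball p R, φ z = 0 := by
  intro z hz
  have hzR : dist z p < R := hz
  obtain ⟨ρ, h1, h2⟩ := exists_between hzR
  have hρ : 0 < ρ := dist_nonneg.trans_lt h1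
  obtain ⟨u, hu, huφ, hP⟩ := local_polar Ω hΩ φ lam hsmooth heqn p R (hρ.trans h2) hball ρ hρ h2
  obtain ⟨V, hV, hVo, hpV⟩ := eventually_nhds_iff.1 h0
  have hflat : ∀ k t, Drk (fun z => u (pol p z)) k (0, t) = 0 := by
    intro k t
    refine Drk_zero_of_eventually _ (pol p ⁻¹' (V ∩ Metric.ball p ρ))
      ((hVo.inter Metric.isOpen_ball).preimage (contDiff_pol p).continuous) ?_ k _ ?_
    · intro w hw
      show u (pol p w) = 0
      rw [huφ _ hw.2]; exact hV _ hw.1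
    · have : pol p (0, t) = p := by simp [pol]
      rw [mem_preimage, this]
      exact ⟨hpV, Metric.mem_ball_self hρ⟩
  obtain ⟨r, t, hr, _, rfl⟩ := exists_pol p z
  rw [dist_pol, abs_of_nonneg hr] at h1
  rw [← huφ _ (by rw [Metric.mem_ball, dist_pol, abs_of_nonneg hr]; exact h1)]
  exact hP.suc hflat r hr h1 t

/-- The eigenfunction is not locally zero anywhere. -/
lemma not_locally_zero (Ω : Set E2) (hΩ : IsOpen Ω) (φ : E2 → ℝ) (lam : ℝ)
    (hsmooth : ContDiffOn ℝ (⊤ : ℕ∞) φ Ω) (heqn : ∀ z ∈ Ω, negLap φ z = lam * φ z)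
    (hnz : ∀ z ∈ Ω, ¬ ∀ w ∈ connectedComponentIn Ω z, φ w = 0) (p : E2) (hp : p ∈ Ω) :
    ¬ (φ =ᶠ[nhds p] fun _ => 0) := by
  intro h0
  apply hnz p hp
  set Z : Set E2 := {z | φ =ᶠ[nhds z] fun _ => 0} with hZ
  have hZo : IsOpen Z := isOpen_setOfPred_eventually_nhds
  have hsub : connectedComponentIn Ω p ⊆ Z := by
    refine isPreconnected_connectedComponentIn.subset_of_closure_inter_subset hZo
      ⟨p, mem_connectedComponentIn hp, h0⟩ ?_
    rintro z ⟨hz, hzc⟩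
    have hzΩ : z ∈ Ω := connectedComponentIn_subset _ _ hzc
    obtain ⟨ε, hε, hεΩ⟩ := Metric.isOpen_iff.1 hΩ z hzΩ
    obtain ⟨q, hqZ, hq⟩ := Metric.mem_closure_iff.1 hz (ε / 2) (by positivity)
    have hb : Metric.ball q (ε / 2) ⊆ Ω := by
      refine (Metric.ball_subset_ball' ?_).trans hεΩ
      rw [dist_comm]; linarith
    have := zero_on_ball Ω hΩ φ lam hsmooth heqn q (ε / 2) hb hqZ
    have hzq : z ∈ Metric.ball q (ε / 2) := hq
    filter_upwards [Metric.isOpen_ball.mem_nhds hzq] with y hy using this y hy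
  intro w hw
  exact (hsub hw).self_of_nhds


/-- For an eigenfunction `φ` of the Laplacian on an open planar set, not identically
zero on any connected component, the set of nodal critical points is discrete, and the
nodal set has no isolated points. -/
theorem nodal_critical_points_discrete_and_nodal_set_no_isolated_points
    (Ω : Set E2) (hΩ : IsOpen Ω) (φ : E2 → ℝ) (lam : ℝ)
    (hsmooth : ContDiffOn ℝ (⊤ : ℕ∞) φ Ω)
    (heqn : ∀ z ∈ Ω, negLap φ z = lam * φ z)
    (hnz : ∀ z ∈ Ω, ¬ ∀ w ∈ connectedComponentIn Ω z, φ w = 0) :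
    (∀ p ∈ {z ∈ Ω | φ z = 0 ∧ fderiv ℝ φ z = 0},
      ∃ U : Set E2, IsOpen U ∧ p ∈ U ∧
        {z ∈ Ω | φ z = 0 ∧ fderiv ℝ φ z = 0} ∩ U = {p}) ∧
    (∀ p ∈ {z ∈ Ω | φ z = 0}, p ∈ closure ({z ∈ Ω | φ z = 0} \ {p})) := by
  have setup : ∀ p ∈ Ω, ∃ ρ > 0, Metric.ball p ρ ⊆ Ω ∧ ∃ u : E2 → ℝ,
      ContDiff ℝ (⊤ : ℕ∞) u ∧ (∀ z ∈ Metric.ball p ρ, u z = φ z) ∧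
      PolarSol (fun z => u (pol p z)) ρ lam := by
    intro p hp
    obtain ⟨ε, hε, hεΩ⟩ := Metric.isOpen_iff.1 hΩ p hp
    exact ⟨ε / 2, by positivity, (Metric.ball_subset_ball (by linarith)).trans hεΩ,
      local_polar Ω hΩ φ lam hsmooth heqn p ε hε hεΩ (ε / 2) (by positivity) (by linarith)⟩
  have hp0 : ∀ (p : E2) t, pol p (0, t) = p := fun p t => by simp [pol]
  constructor
  · rintro p ⟨hp, hφp, hdp⟩
    obtain ⟨ρ, hρ, hρΩ, u, hu, huφ, hP⟩ := setup p hp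
    have h0 : ∀ t, u (pol p (0, t)) = 0 := fun t => by
      rw [hp0, huφ p (Metric.mem_ball_self hρ), hφp]
    have hne : ∃ k t, Drk (fun z => u (pol p z)) k (0, t) ≠ 0 := by
      by_contra hcon
      push Not at hcon
      apply not_locally_zero Ω hΩ φ lam hsmooth heqn hnz p hp
      filter_upwards [Metric.ball_mem_nhds p hρ] with z hz
      rw [← huφ z hz]
      obtain ⟨r, t, hr, _, rfl⟩ := exists_pol p z
      rw [Metric.mem_ball, dist_pol, abs_of_nonneg hr] at hz
      exact hP.suc hcon r hr hz t
    obtain ⟨δ, hδ, hiso⟩ := hP.isolated h0 hne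
    refine ⟨Metric.ball p (min δ ρ), Metric.isOpen_ball,
      Metric.mem_ball_self (by positivity), ?_⟩
    apply Subset.antisymm
    · rintro z ⟨⟨hz, hφz, hdz⟩, hzb⟩
      obtain ⟨r, t, hr, ht, rfl⟩ := exists_pol p z
      have hzb' := hzb
      rw [Metric.mem_ball, dist_pol, abs_of_nonneg hr] at hzb
      have hzρ : pol p (r, t) ∈ Metric.ball p ρ :=
        Metric.ball_subset_ball (min_le_right _ _) hzb'
      rcases hr.eq_or_lt with rfl | hr'
      · exact hp0 p t
      · exfalso
        refine hiso r t hr' (hzb.trans_le (min_le_left _ _)) ht ⟨?_, ?_⟩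
        · show u (pol p (r, t)) = 0
          rw [huφ _ hzρ, hφz]
        · have hev : u =ᶠ[nhds (pol p (r, t))] φ := by
            filter_upwards [Metric.isOpen_ball.mem_nhds hzρ] with y hy using huφ y hy
          rw [(hasDerivAt_t hP.smooth r t).unique (pol_hasDerivAt_t p u hu r t),
            hev.fderiv_eq, hdz]
          simp
    · rintro z rfl
      exact ⟨⟨hp, hφp, hdp⟩, Metric.mem_ball_self (by positivity)⟩
  · rintro p ⟨hp, hφp⟩
    obtain ⟨ρ, hρ, hρΩ, u, hu, huφ, hP⟩ := setup p hp
    have h0 : ∀ t, u (pol p (0, t)) = 0 := fun t => by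
      rw [hp0, huφ p (Metric.mem_ball_self hρ), hφp]
    rw [Metric.mem_closure_iff]
    intro ε hε
    have hr : 0 < min ε ρ / 2 := by positivity
    have hr1 : min ε ρ / 2 < ε := by linarith [min_le_left ε ρ]
    have hr2 : min ε ρ / 2 < ρ := by linarith [min_le_right ε ρ]
    obtain ⟨t, ht⟩ := hP.exists_zero h0 _ hr.le hr2
    have hd := dist_pol p (min ε ρ / 2) t
    rw [abs_of_pos hr] at hd
    have hb : pol p (min ε ρ / 2, t) ∈ Metric.ball p ρ := by
      rw [Metric.mem_ball, hd]; exact hr2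
    refine ⟨pol p (min ε ρ / 2, t), ⟨⟨hρΩ hb, ?_⟩, ?_⟩, ?_⟩
    · rw [← huφ _ hb]; exact ht
    · intro h
      rw [mem_singleton_iff] at h
      rw [h, dist_self] at hd
      linarith
    · rw [dist_comm, hd]; exact hr1

end
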